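/- For every positive integer n, the following identity of polynomials in z holds: (Σ over matrices A in M_n with n − dim(A) even of z^{rsum_1(A)}) − (Σ over matrices A in M_n with n − dim(A) odd of z^{rsum_1(A)}) = Σ over matrices A in PM_n of z^{rsum_1(A)}. -/

import Mathlib

open Polynomial

/-- A finite square matrix of natural numbers, of arbitrary dimension. -/
def SqMat : Type := Σ d : ℕ, Matrix (Fin d) (Fin d) ℕ

namespace SqMat

/-- The number of rows (= number of columns) of the matrix. -/
def dim (A : SqMat) : ℕ := A.1

/-- The entry in row `r`, column `c` (0-indexed), and `0` out of range. -/
def ent (A : SqMat) (r c : ℕ) : ℕ :=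
  if h : r < A.1 ∧ c < A.1 then A.2 ⟨r, h.1⟩ ⟨c, h.2⟩ else 0

/-- The sum of the entries of row `i` (0-indexed). -/
def rsum (A : SqMat) (i : ℕ) : ℕ := ∑ j ∈ Finset.range A.1, A.ent i j

/-- The sum of the entries of column `j` (0-indexed). -/
def csum (A : SqMat) (j : ℕ) : ℕ := ∑ i ∈ Finset.range A.1, A.ent i j

/-- The sum of all entries of the matrix. -/
def total (A : SqMat) : ℕ := ∑ i ∈ Finset.range A.1, A.rsum i

/-- The least row index (0-indexed) at which column `j` has a nonzero entry. -/
noncomputable def colMin (A : SqMat) (j : ℕ) : ℕ := sInf {i : ℕ | A.ent i j ≠ 0}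

/-- The matrix is upper triangular. -/
def UpperTri (A : SqMat) : Prop := ∀ r c : ℕ, c < r → A.ent r c = 0

/-- All entries are `0` or `1`. -/
def ZeroOne (A : SqMat) : Prop := ∀ r c : ℕ, A.ent r c ≤ 1

/-- Every column contains at least one nonzero entry. -/
def ColsNonzero (A : SqMat) : Prop := ∀ j < A.1, 0 < A.csum j

/-- Every row contains at least one nonzero entry. -/
def RowsNonzero (A : SqMat) : Prop := ∀ i < A.1, 0 < A.rsum i

/-- Membership in `M_n`: upper triangular `(0,1)`-matrices with entries summing
to `n` in which every column contains at least one nonzero entry. -/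
def MemM (n : ℕ) (A : SqMat) : Prop :=
  A.UpperTri ∧ A.ZeroOne ∧ A.total = n ∧ A.ColsNonzero

/-- Column `j` (0-indexed; so `j` corresponds to the 1-indexed column `j+1` of the paper)
is improper: either its column sum is at least `2`, or `j ≥ 1`, its column sum is `1`,
its row sum is `0`, and `min_j(A) < min_{j-1}(A)`. -/
def ImproperCol (A : SqMat) (j : ℕ) : Prop :=
  2 ≤ A.csum j ∨
    (1 ≤ j ∧ A.csum j = 1 ∧ A.rsum j = 0 ∧ A.colMin j < A.colMin (j - 1))

/-- The matrix is proper: no column is improper. -/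
def Proper (A : SqMat) : Prop := ∀ j < A.1, ¬ A.ImproperCol j

/-- Membership in `PM_n`: proper matrices of `M_n`. -/
def MemPM (n : ℕ) (A : SqMat) : Prop := MemM n A ∧ A.Proper

/-- Membership in `I_n`: upper triangular matrices with non-negative integer entries
summing to `n` in which every row and every column contains at least one nonzero entry. -/
def MemI (n : ℕ) (A : SqMat) : Prop :=
  A.UpperTri ∧ A.total = n ∧ A.RowsNonzero ∧ A.ColsNonzero

end SqMat

namespace SqMat

/-! ### Inserting an index -/

/-- The order embedding of `ℕ` into `ℕ` whose range omits exactly `k`. -/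
def skip (k i : ℕ) : ℕ := if i < k then i else i + 1

theorem skip_of_lt {k i : ℕ} (h : i < k) : skip k i = i := if_pos h

theorem skip_of_le {k i : ℕ} (h : k ≤ i) : skip k i = i + 1 := if_neg h.not_gt

theorem skip_lt_skip {k a b : ℕ} : skip k a < skip k b ↔ a < b := by
  unfold skip; split_ifs <;> omega

theorem eq_or_exists_eq_skip (k r : ℕ) : r = k ∨ ∃ i, r = skip k i := by
  rcases lt_trichotomy r k with h | h | h
  · exact Or.inr ⟨r, (skip_of_lt h).symm⟩
  · exact Or.inl h
  · exact Or.inr ⟨r - 1, by rw [skip_of_le (by omega)]; omega⟩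

theorem sum_range_succ_skip (f : ℕ → ℕ) {k d : ℕ} (h : k ≤ d) :
    ∑ i ∈ Finset.range (d + 1), f i = f k + ∑ i ∈ Finset.range d, f (skip k i) := by
  induction d with
  | zero => obtain rfl : k = 0 := by omega
            simp
  | succ d ih =>
    rcases h.lt_or_eq with h' | rfl
    · rw [Finset.sum_range_succ, ih (by omega), Finset.sum_range_succ _ d,
        skip_of_le (by omega : k ≤ d)]
      ring
    · rw [Finset.sum_range_succ, add_comm]
      congr 1
      exact Finset.sum_congr rfl fun i hi => by rw [skip_of_lt (Finset.mem_range.1 hi)]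

/-! ### Matrices through their entries -/

theorem ent_eq_zero_of_le_row (A : SqMat) {r : ℕ} (c : ℕ) (h : A.1 ≤ r) : A.ent r c = 0 :=
  dif_neg fun h' => by omega

theorem ent_eq_zero_of_le_col (A : SqMat) (r : ℕ) {c : ℕ} (h : A.1 ≤ c) : A.ent r c = 0 :=
  dif_neg fun h' => by omega

theorem ext_ent {A B : SqMat} (hd : A.1 = B.1) (he : ∀ r c, A.ent r c = B.ent r c) : A = B := by
  obtain ⟨d, a⟩ := A
  obtain ⟨e, b⟩ := B
  obtain rfl : d = e := hd
  congr 1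
  ext i j
  simpa [ent] using he i j

theorem exists_ent_eq (d : ℕ) (f : ℕ → ℕ → ℕ) (hf : ∀ r c, d ≤ r ∨ d ≤ c → f r c = 0) :
    ∃ A : SqMat, A.1 = d ∧ ∀ r c, A.ent r c = f r c := by
  refine ⟨⟨d, fun i j => f i j⟩, rfl, fun r c => ?_⟩
  by_cases h : r < d ∧ c < d
  · simp [ent, h]
  · rw [hf r c (by omega)]
    exact dif_neg h

theorem total_eq_sum_csum (A : SqMat) : A.total = ∑ j ∈ Finset.range A.1, A.csum j :=
  Finset.sum_comm

theorem exists_ent_ne_zero {A : SqMat} {c : ℕ} (h : 0 < A.csum c) : ∃ r, A.ent r c ≠ 0 := by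
  obtain ⟨r, -, hr⟩ := Finset.exists_ne_zero_of_sum_ne_zero h.ne'
  exact ⟨r, hr⟩

theorem ent_colMin_ne_zero {A : SqMat} {c : ℕ} (h : 0 < A.csum c) : A.ent (A.colMin c) c ≠ 0 :=
  Nat.sInf_mem (exists_ent_ne_zero h)

theorem ent_eq_zero_of_lt_colMin {A : SqMat} {r c : ℕ} (h : r < A.colMin c) : A.ent r c = 0 := by
  simpa using Nat.notMem_of_lt_sInf h

theorem UpperTri.colMin_le {A : SqMat} (hA : A.UpperTri) {c : ℕ} (h : 0 < A.csum c) :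
    A.colMin c ≤ c := by
  by_contra! hlt
  exact ent_colMin_ne_zero h (hA _ _ hlt)

theorem colMin_eq {A : SqMat} {m c : ℕ} (hm : A.ent m c ≠ 0) (hlt : ∀ r < m, A.ent r c = 0) :
    A.colMin c = m := by
  refine le_antisymm (Nat.sInf_le hm) ?_
  by_contra! h
  exact Nat.sInf_mem (⟨m, hm⟩ : {i : ℕ | A.ent i c ≠ 0}.Nonempty) (hlt _ h)

theorem ent_add_ent_le_csum (A : SqMat) {r s : ℕ} (c : ℕ) (h : r ≠ s) :
    A.ent r c + A.ent s c ≤ A.csum c := by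
  by_cases hr : r < A.1
  · by_cases hs : s < A.1
    · rw [← Finset.sum_pair (f := fun i => A.ent i c) h]
      refine Finset.sum_le_sum_of_subset fun i hi => ?_
      rcases Finset.mem_insert.1 hi with rfl | hi
      · exact Finset.mem_range.2 hr
      · exact Finset.mem_range.2 (Finset.mem_singleton.1 hi ▸ hs)
    · rw [ent_eq_zero_of_le_row A c (not_lt.1 hs), add_zero]
      exact Finset.single_le_sum (f := fun i => A.ent i c) (fun _ _ => Nat.zero_le _)
        (Finset.mem_range.2 hr)
  · rw [ent_eq_zero_of_le_row A c (not_lt.1 hr), zero_add]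
    by_cases hs : s < A.1
    · exact Finset.single_le_sum (f := fun i => A.ent i c) (fun _ _ => Nat.zero_le _)
        (Finset.mem_range.2 hs)
    · rw [ent_eq_zero_of_le_row A c (not_lt.1 hs)]
      exact Nat.zero_le _

theorem MemM.dim_le {n : ℕ} {A : SqMat} (h : MemM n A) : A.dim ≤ n := by
  obtain ⟨-, -, rfl, hc⟩ := h
  rw [total_eq_sum_csum]
  calc A.dim = ∑ _j ∈ Finset.range A.1, 1 := by simp [dim]
    _ ≤ _ := Finset.sum_le_sum fun j hj => hc j (Finset.mem_range.1 hj)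

theorem MemPM.dim_eq {n : ℕ} {A : SqMat} (h : MemPM n A) : A.dim = n := by
  obtain ⟨⟨-, -, rfl, hc⟩, hp⟩ := h
  rw [total_eq_sum_csum]
  calc A.dim = ∑ _j ∈ Finset.range A.1, 1 := by simp [dim]
    _ = _ := Finset.sum_congr rfl fun j hj => by
      have h1 := hc j (Finset.mem_range.1 hj)
      have h2 : ¬ 2 ≤ A.csum j := fun h => hp j (Finset.mem_range.1 hj) (Or.inl h)
      omega

theorem finite_setOf_memM (n : ℕ) : {A : SqMat | MemM n A}.Finite := by
  have hfin : (⋃ d ∈ Set.Iic n, (fun a : Fin d → Fin d → ℕ => (⟨d, a⟩ : SqMat)) ''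
      Set.Iic (fun _ _ => 1)).Finite :=
    (Set.finite_Iic n).biUnion fun d _ => (Set.finite_Iic _).image _
  refine hfin.subset fun A hA => ?_
  refine Set.mem_biUnion (x := A.1) hA.dim_le ⟨A.2, fun i j => ?_, rfl⟩
  simpa [ent] using hA.2.1 i j

/-! ### Splitting the topmost entry off a column -/

/-- `B` arises from `A` by inserting a zero row and a new column after index `j`, and moving the
topmost entry of column `j`, which is a `1` in row `m`, to the new column. -/
structure Splits (A : SqMat) (j m : ℕ) (B : SqMat) : Prop where
  dim_eq : B.1 = A.1 + 1
  lt : j < A.1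
  le : m ≤ j
  ent_new_row : ∀ c, B.ent (j + 1) c = 0
  ent_of_ne : ∀ r c, c ≠ j → B.ent (skip (j + 1) r) (skip (j + 1) c) = A.ent r c
  ent_col : ∀ r, B.ent (skip (j + 1) r) j = if r = m then 0 else A.ent r j
  ent_new_col : ∀ r, B.ent (skip (j + 1) r) (j + 1) = if r = m then 1 else 0
  ent_min : A.ent m j = 1
  ent_lt : ∀ r < m, A.ent r j = 0

theorem exists_splits {A : SqMat} {j : ℕ} (hU : A.UpperTri) (hZ : A.ZeroOne) (hj : j < A.1)
    (hc : 0 < A.csum j) : ∃ B, Splits A j (A.colMin j) B := by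
  set m := A.colMin j with hm
  have hmj : m ≤ j := hU.colMin_le hc
  have hm1 : A.ent m j = 1 := by
    have : A.ent m j ≠ 0 := ent_colMin_ne_zero hc
    have : A.ent m j ≤ 1 := hZ m j
    omega
  let u : ℕ → ℕ := fun r => if r ≤ j + 1 then r else r - 1
  have hu : ∀ r, u (skip (j + 1) r) = r := fun r => by
    simp only [u, skip]; split_ifs <;> omega
  have hs : ∀ r, skip (j + 1) r ≠ j + 1 := fun r => by
    unfold skip; split_ifs <;> omega
  have hsj : ∀ c, c ≠ j → skip (j + 1) c ≠ j := fun c => by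
    unfold skip; split_ifs <;> omega
  have huj : u j = j := if_pos (by omega)
  obtain ⟨B, hd, hB⟩ := exists_ent_eq (A.1 + 1)
    (fun r c => if r = j + 1 then 0 else if c = j + 1 then (if u r = m then 1 else 0) else
      if c = j ∧ u r = m then 0 else A.ent (u r) (u c)) (by
    intro r c h
    by_cases hr : r = j + 1
    · simp [hr]
    have hur : A.1 + 1 ≤ r → A.1 ≤ u r := fun h => by simp only [u]; split_ifs <;> omega
    have huc : A.1 + 1 ≤ c → c ≠ j + 1 → A.1 ≤ u c := fun h h' => by
      simp only [u]; split_ifs <;> omega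
    simp only [if_neg hr]
    split_ifs with h1 h2 h3
    · exfalso; rcases h with h | h
      · have := hur h; omega
      · omega
    · rfl
    · rfl
    · rcases h with h | h
      · exact ent_eq_zero_of_le_row _ _ (hur h)
      · exact ent_eq_zero_of_le_col _ _ (huc h h1))
  refine ⟨B, hd, hj, hmj, fun c => ?_, fun r c h => ?_, fun r => ?_, fun r => ?_, hm1,
    fun r hr => ent_eq_zero_of_lt_colMin hr⟩
  · simp [hB]
  · simp [hB, hs, hsj c h, hu]
  · simp [hB, hs, hu, huj]
  · simp [hB, hs, hu]

theorem exists_splits_of_improper {B : SqMat} {j : ℕ} (hU : B.UpperTri) (hZ : B.ZeroOne)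
    (hC : B.ColsNonzero) (hj : j + 1 < B.1) (hc : B.csum (j + 1) = 1) (hr : B.rsum (j + 1) = 0)
    (hlt : B.colMin (j + 1) < B.colMin j) : ∃ A, Splits A j (B.colMin (j + 1)) B := by
  set m := B.colMin (j + 1) with hm
  have hmj : m ≤ j := hlt.le.trans (hU.colMin_le (hC j (by omega)))
  have hm1 : B.ent m (j + 1) = 1 := by
    have : B.ent m (j + 1) ≠ 0 := ent_colMin_ne_zero (by omega)
    have : B.ent m (j + 1) ≤ 1 := hZ m (j + 1)
    omega
  have hne : ∀ r, r ≠ m → B.ent r (j + 1) = 0 := fun r h => by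
    have := ent_add_ent_le_csum B (j + 1) h
    omega
  have hsk : ∀ r ≤ j, skip (j + 1) r = r := fun r h => skip_of_lt (by omega)
  have hskm : ∀ r, skip (j + 1) r = m ↔ r = m := fun r => by
    unfold skip; split_ifs <;> omega
  obtain ⟨A, hd, hA⟩ := exists_ent_eq (B.1 - 1)
    (fun r c => if c = j then B.ent (skip (j + 1) r) j + B.ent (skip (j + 1) r) (j + 1) else
      B.ent (skip (j + 1) r) (skip (j + 1) c)) (by
    intro r c h
    have hle : ∀ i, B.1 - 1 ≤ i → B.1 ≤ skip (j + 1) i := fun i h => by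
      rw [skip_of_le (by omega)]; omega
    rcases h with h | h
    · simp [ent_eq_zero_of_le_row B _ (hle r h)]
    · rw [if_neg (by omega), ent_eq_zero_of_le_col B _ (hle c h)])
  refine ⟨A, by omega, by omega, hmj, fun c => ?_, fun r c h => ?_, fun r => ?_, fun r => ?_, ?_,
    fun r h => ?_⟩
  · by_cases h : c < B.1
    · exact Finset.sum_eq_zero_iff.1 hr c (Finset.mem_range.2 h)
    · exact ent_eq_zero_of_le_col _ _ (not_lt.1 h)
  · rw [hA, if_neg h]
  · rw [hA, if_pos rfl]
    split_ifs with h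
    · subst h
      rw [hsk _ hmj]
      exact ent_eq_zero_of_lt_colMin hlt
    · rw [hne _ ((hskm r).not.2 h), add_zero]
  · split_ifs with h
    · subst h
      rw [hsk _ hmj, hm1]
    · exact hne _ ((hskm r).not.2 h)
  · rw [hA, if_pos rfl, hsk _ hmj, hm1, ent_eq_zero_of_lt_colMin hlt]
  · rw [hA, if_pos rfl, hsk _ (by omega), hne r h.ne, ent_eq_zero_of_lt_colMin (h.trans hlt)]

namespace Splits

variable {A B : SqMat} {j m : ℕ}

theorem colMin_eq (h : Splits A j m B) : A.colMin j = m :=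
  SqMat.colMin_eq (by simp [h.ent_min]) h.ent_lt

theorem skip_min (h : Splits A j m B) : skip (j + 1) m = m :=
  skip_of_lt (Nat.lt_succ_of_le h.le)

theorem right_unique {m' : ℕ} {B' : SqMat} (h : Splits A j m B) (h' : Splits A j m' B') :
    B = B' := by
  obtain rfl : m = m' := h.colMin_eq.symm.trans h'.colMin_eq
  refine ext_ent (by rw [h.dim_eq, h'.dim_eq]) fun r c => ?_
  rcases eq_or_exists_eq_skip (j + 1) r with rfl | ⟨r, rfl⟩
  · rw [h.ent_new_row, h'.ent_new_row]
  rcases eq_or_exists_eq_skip (j + 1) c with rfl | ⟨c, rfl⟩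
  · rw [h.ent_new_col, h'.ent_new_col]
  by_cases hc : c = j
  · rw [hc, skip_of_lt (Nat.lt_succ_self j), h.ent_col, h'.ent_col]
  · rw [h.ent_of_ne r c hc, h'.ent_of_ne r c hc]

theorem ent_left (h : Splits A j m B) (r : ℕ) :
    A.ent r j = B.ent (skip (j + 1) r) j + B.ent (skip (j + 1) r) (j + 1) := by
  rw [h.ent_col, h.ent_new_col]
  split_ifs with hr
  · rw [hr, h.ent_min]
  · rfl

theorem left_unique {m' : ℕ} {A' : SqMat} (h : Splits A j m B) (h' : Splits A' j m' B) :
    A = A' := by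
  refine ext_ent (by have := h.dim_eq; have := h'.dim_eq; omega) fun r c => ?_
  by_cases hc : c = j
  · rw [hc, h.ent_left, h'.ent_left]
  · rw [← h.ent_of_ne r c hc, ← h'.ent_of_ne r c hc]

theorem csum_right (h : Splits A j m B) (c : ℕ) :
    B.csum c = ∑ r ∈ Finset.range A.1, B.ent (skip (j + 1) r) c := by
  rw [csum, h.dim_eq, sum_range_succ_skip _ h.lt, h.ent_new_row, zero_add]

theorem csum_of_ne (h : Splits A j m B) {c : ℕ} (hc : c ≠ j) :
    B.csum (skip (j + 1) c) = A.csum c := by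
  rw [h.csum_right]
  exact Finset.sum_congr rfl fun r _ => h.ent_of_ne r c hc

theorem csum_new (h : Splits A j m B) : B.csum (j + 1) = 1 := by
  rw [h.csum_right, Finset.sum_congr rfl fun r _ => h.ent_new_col r]
  simp [h.le.trans_lt h.lt]

theorem csum_left (h : Splits A j m B) : A.csum j = B.csum j + 1 := by
  rw [← h.csum_new, h.csum_right, h.csum_right, ← Finset.sum_add_distrib]
  exact Finset.sum_congr rfl fun r _ => h.ent_left r

theorem rsum_new (h : Splits A j m B) : B.rsum (j + 1) = 0 :=
  Finset.sum_eq_zero fun c _ => h.ent_new_row c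

theorem rsum_skip (h : Splits A j m B) (r : ℕ) : B.rsum (skip (j + 1) r) = A.rsum r := by
  have hj := Finset.mem_range.2 h.lt
  rw [rsum, rsum, h.dim_eq, sum_range_succ_skip _ h.lt, ← Finset.add_sum_erase _ _ hj,
    ← Finset.add_sum_erase _ _ hj, h.ent_left, skip_of_lt (Nat.lt_succ_self j),
    Finset.sum_congr rfl fun c hc => h.ent_of_ne r c (Finset.ne_of_mem_erase hc)]
  ring

theorem rsum_zero (h : Splits A j m B) : B.rsum 0 = A.rsum 0 := by
  simpa [skip_of_lt (Nat.succ_pos j)] using h.rsum_skip 0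

theorem total_eq (h : Splits A j m B) : B.total = A.total := by
  rw [total, total, h.dim_eq, sum_range_succ_skip _ h.lt, h.rsum_new, zero_add]
  exact Finset.sum_congr rfl fun r _ => h.rsum_skip r

theorem upperTri_iff (h : Splits A j m B) : B.UpperTri ↔ A.UpperTri := by
  constructor
  · intro hB r c hrc
    by_cases hc : c = j
    · subst hc
      rw [h.ent_left, skip_of_le hrc, hB _ _ (by omega), hB _ _ (by omega)]
    · rw [← h.ent_of_ne r c hc]
      exact hB _ _ (skip_lt_skip.2 hrc)
  · intro hA r c hrc
    rcases eq_or_exists_eq_skip (j + 1) r with rfl | ⟨r, rfl⟩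
    · exact h.ent_new_row c
    rcases eq_or_exists_eq_skip (j + 1) c with rfl | ⟨c, rfl⟩
    · rw [h.ent_new_col, if_neg]
      rintro rfl
      have := h.skip_min
      have := h.le
      omega
    by_cases hc : c = j
    · subst hc
      rw [skip_of_lt (Nat.lt_succ_self c), h.ent_col, hA _ _ (skip_lt_skip.1 hrc), ite_self]
    · rw [h.ent_of_ne r c hc]
      exact hA _ _ (skip_lt_skip.1 hrc)

theorem zeroOne_iff (h : Splits A j m B) : B.ZeroOne ↔ A.ZeroOne := by
  constructor
  · intro hB r c
    by_cases hc : c = j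
    · subst hc
      by_cases hr : r = m
      · rw [hr, h.ent_min]
      · have := h.ent_col r
        rw [if_neg hr] at this
        exact this ▸ hB _ _
    · rw [← h.ent_of_ne r c hc]
      exact hB _ _
  · intro hA r c
    rcases eq_or_exists_eq_skip (j + 1) r with rfl | ⟨r, rfl⟩
    · simp [h.ent_new_row c]
    rcases eq_or_exists_eq_skip (j + 1) c with rfl | ⟨c, rfl⟩
    · rw [h.ent_new_col]
      split_ifs <;> simp
    by_cases hc : c = j
    · subst hc
      rw [skip_of_lt (Nat.lt_succ_self c), h.ent_col]
      split_ifs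
      · exact Nat.zero_le _
      · exact hA _ _
    · rw [h.ent_of_ne r c hc]
      exact hA _ _

theorem colsNonzero_left (h : Splits A j m B) (hB : B.ColsNonzero) : A.ColsNonzero := by
  intro c hc
  by_cases hcj : c = j
  · rw [hcj, h.csum_left]
    exact Nat.succ_pos _
  · rw [← h.csum_of_ne hcj]
    refine hB _ ?_
    rw [h.dim_eq]
    unfold skip
    split_ifs <;> omega

theorem colsNonzero_right (h : Splits A j m B) (h2 : 2 ≤ A.csum j) (hA : A.ColsNonzero) :
    B.ColsNonzero := by
  intro c hc
  rcases eq_or_exists_eq_skip (j + 1) c with rfl | ⟨c, rfl⟩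
  · rw [h.csum_new]
    exact Nat.one_pos
  by_cases hcj : c = j
  · have := h.csum_left
    rw [hcj, skip_of_lt (Nat.lt_succ_self j)]
    omega
  · rw [h.csum_of_ne hcj]
    refine hA _ ?_
    have := h.dim_eq
    have := h.lt
    unfold skip at hc
    split_ifs at hc <;> omega

theorem memM_left {n : ℕ} (h : Splits A j m B) (hB : MemM n B) : MemM n A :=
  ⟨h.upperTri_iff.1 hB.1, h.zeroOne_iff.1 hB.2.1, h.total_eq ▸ hB.2.2.1,
    h.colsNonzero_left hB.2.2.2⟩

theorem memM_right {n : ℕ} (h : Splits A j m B) (h2 : 2 ≤ A.csum j) (hA : MemM n A) : MemM n B :=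
  ⟨h.upperTri_iff.2 hA.1, h.zeroOne_iff.2 hA.2.1, h.total_eq.trans hA.2.2.1,
    h.colsNonzero_right h2 hA.2.2.2⟩

theorem colMin_new (h : Splits A j m B) : B.colMin (j + 1) = m := by
  refine SqMat.colMin_eq ?_ fun r hr => ?_
  · have := h.ent_new_col m
    rw [h.skip_min, if_pos rfl] at this
    omega
  · have := h.ent_new_col r
    rwa [skip_of_lt (by have := h.le; omega), if_neg hr.ne] at this

theorem colMin_skip (h : Splits A j m B) {c : ℕ} (hc : c ≠ j) (h0 : 0 < A.csum c) :
    B.colMin (skip (j + 1) c) = skip (j + 1) (A.colMin c) := by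
  refine SqMat.colMin_eq ?_ fun r hr => ?_
  · rw [h.ent_of_ne _ c hc]
    exact ent_colMin_ne_zero h0
  · rcases eq_or_exists_eq_skip (j + 1) r with rfl | ⟨r, rfl⟩
    · exact h.ent_new_row _
    · rw [h.ent_of_ne _ c hc]
      exact ent_eq_zero_of_lt_colMin (skip_lt_skip.1 hr)

theorem colMin_succ (h : Splits A j m B) {c : ℕ} (hc : j ≤ c) (h0 : 0 < A.csum c) :
    B.colMin (c + 1) = skip (j + 1) (A.colMin c) := by
  rcases hc.eq_or_lt with rfl | hc
  · rw [h.colMin_new, h.colMin_eq, h.skip_min]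
  · rw [← skip_of_le hc]
    exact h.colMin_skip hc.ne' h0

theorem improperCol_succ_iff (h : Splits A j m B) (hA : A.ColsNonzero) {c : ℕ} (hjc : j < c)
    (hc : c < A.1) : B.ImproperCol (c + 1) ↔ A.ImproperCol c := by
  have hs : B.csum (c + 1) = A.csum c := by
    rw [← skip_of_le hjc]
    exact h.csum_of_ne hjc.ne'
  have hr : B.rsum (c + 1) = A.rsum c := by
    rw [← skip_of_le hjc]
    exact h.rsum_skip c
  have hm : B.colMin (c + 1 - 1) = skip (j + 1) (A.colMin (c - 1)) := by
    rw [← h.colMin_succ (by omega) (hA _ (by omega)), Nat.sub_add_cancel (by omega),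
      Nat.add_sub_cancel]
  rw [ImproperCol, ImproperCol, hs, hr, hm, h.colMin_succ hjc.le (hA c hc), skip_lt_skip]
  simp [show 1 ≤ c by omega]

theorem improperCol_new (h : Splits A j m B) (h2 : 2 ≤ A.csum j) : B.ImproperCol (j + 1) := by
  refine Or.inr ⟨Nat.succ_pos j, h.csum_new, h.rsum_new, ?_⟩
  rw [h.colMin_new, Nat.add_sub_cancel]
  have hne := ent_colMin_ne_zero (A := B) (c := j) (by have := h.csum_left; omega)
  by_contra! hle
  refine hne ?_
  have := h.ent_col (B.colMin j)
  rw [skip_of_lt (by have := h.le; omega)] at this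
  rw [this]
  split_ifs with hm
  · rfl
  · exact h.ent_lt _ (by omega)

end Splits

/-! ### The last improper column -/

/-- `j` is the last improper column of `A`. -/
def IsLastImproper (A : SqMat) (j : ℕ) : Prop :=
  j < A.1 ∧ A.ImproperCol j ∧ ∀ c, j < c → c < A.1 → ¬ A.ImproperCol c

theorem IsLastImproper.unique {A : SqMat} {i j : ℕ} (hi : A.IsLastImproper i)
    (hj : A.IsLastImproper j) : i = j := by
  rcases lt_trichotomy i j with h | h | h
  · exact absurd hj.2.1 (hi.2.2 j h hj.1)
  · exact h
  · exact absurd hi.2.1 (hj.2.2 i h hi.1)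

theorem exists_isLastImproper {A : SqMat} (h : ¬ A.Proper) : ∃ j, A.IsLastImproper j := by
  classical
  simp only [Proper, not_forall, not_not] at h
  obtain ⟨i, hi, hi'⟩ := h
  have hne : ((Finset.range A.1).filter A.ImproperCol).Nonempty := ⟨i, by simp [hi, hi']⟩
  obtain ⟨j, hj, hmax⟩ := Finset.exists_max_image _ id hne
  simp only [Finset.mem_filter, Finset.mem_range, id, and_imp] at hj hmax
  exact ⟨j, hj.1, hj.2, fun c hjc hc hic => (hmax c hc hic).not_gt hjc⟩

theorem IsLastImproper.not_proper {A : SqMat} {j : ℕ} (h : A.IsLastImproper j) : ¬ A.Proper :=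
  fun hp => hp j h.1 h.2.1

theorem Splits.isLastImproper_right {A B : SqMat} {j m : ℕ} (h : Splits A j m B)
    (hC : A.ColsNonzero) (h2 : 2 ≤ A.csum j) (hj : A.IsLastImproper j) :
    B.IsLastImproper (j + 1) := by
  have hd := h.dim_eq
  refine ⟨by have := h.lt; omega, h.improperCol_new h2, fun c hjc hc => ?_⟩
  obtain ⟨c, rfl⟩ : ∃ c', c = c' + 1 := ⟨c - 1, by omega⟩
  rw [h.improperCol_succ_iff hC (by omega) (by omega)]
  exact hj.2.2 c (by omega) (by omega)

theorem Splits.isLastImproper_left {A B : SqMat} {j m : ℕ} (h : Splits A j m B)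
    (hC : A.ColsNonzero) (h2 : 2 ≤ A.csum j) (hj : B.IsLastImproper (j + 1)) :
    A.IsLastImproper j := by
  have hd := h.dim_eq
  refine ⟨h.lt, Or.inl h2, fun c hjc hc => ?_⟩
  rw [← h.improperCol_succ_iff hC hjc hc]
  exact hj.2.2 _ (by omega) (by omega)

/-- The last improper column of `A` has at least two nonzero entries. -/
def Splittable (A : SqMat) : Prop := ∃ j, A.IsLastImproper j ∧ 2 ≤ A.csum j

/-- `B` arises from `A` by splitting the last improper column of `A`, and the new column is the
last improper column of `B`. -/
def LastSplits (A B : SqMat) : Prop :=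
  ∃ j m, Splits A j m B ∧ A.IsLastImproper j ∧ B.IsLastImproper (j + 1) ∧ 2 ≤ A.csum j

theorem LastSplits.right_unique {A B B' : SqMat} (h : LastSplits A B) (h' : LastSplits A B') :
    B = B' := by
  obtain ⟨j, m, hs, hj, -⟩ := h
  obtain ⟨j', m', hs', hj', -⟩ := h'
  obtain rfl := hj.unique hj'
  exact hs.right_unique hs'

theorem LastSplits.left_unique {A A' B : SqMat} (h : LastSplits A B) (h' : LastSplits A' B) :
    A = A' := by
  obtain ⟨j, m, hs, -, hj, -⟩ := h
  obtain ⟨j', m', hs', -, hj', -⟩ := h'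
  obtain rfl : j = j' := Nat.succ_injective (hj.unique hj')
  exact hs.left_unique hs'

theorem LastSplits.splittable_left {A B : SqMat} (h : LastSplits A B) : A.Splittable := by
  obtain ⟨j, m, -, hj, -, h2⟩ := h
  exact ⟨j, hj, h2⟩

theorem LastSplits.not_splittable_right {A B : SqMat} (h : LastSplits A B) : ¬ B.Splittable := by
  obtain ⟨j, m, hs, -, hj, -⟩ := h
  rintro ⟨i, hi, h2⟩
  rw [hi.unique hj, hs.csum_new] at h2
  omega

theorem LastSplits.not_proper_right {A B : SqMat} (h : LastSplits A B) : ¬ B.Proper := by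
  obtain ⟨j, m, -, -, hj, -⟩ := h
  exact hj.not_proper

theorem MemM.exists_lastSplits_right {n : ℕ} {A : SqMat} (hA : MemM n A) (h : A.Splittable) :
    ∃ B, MemM n B ∧ LastSplits A B := by
  obtain ⟨j, hj, h2⟩ := h
  obtain ⟨B, hB⟩ := exists_splits hA.1 hA.2.1 hj.1 (by omega)
  exact ⟨B, hB.memM_right h2 hA, j, _, hB, hj, hB.isLastImproper_right hA.2.2.2 h2 hj, h2⟩

theorem MemM.exists_lastSplits_left {n : ℕ} {B : SqMat} (hB : MemM n B) (hp : ¬ B.Proper)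
    (h : ¬ B.Splittable) : ∃ A, MemM n A ∧ LastSplits A B := by
  obtain ⟨k, hk⟩ := exists_isLastImproper hp
  obtain h2 | ⟨h1, hc, hr, hlt⟩ := hk.2.1
  · exact absurd ⟨k, hk, h2⟩ h
  obtain ⟨j, rfl⟩ : ∃ j, k = j + 1 := ⟨k - 1, by omega⟩
  obtain ⟨A, hA⟩ := exists_splits_of_improper hB.1 hB.2.1 hB.2.2.2 hk.1 hc hr hlt
  have hAM := hA.memM_left hB
  have h2 : 2 ≤ A.csum j := by
    have := hA.csum_left
    have := hB.2.2.2 j (by have := hk.1; omega)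
    omega
  exact ⟨A, hAM, j, _, hA, hA.isLastImproper_left hAM.2.2.2 h2 hk, hk, h2⟩

/-- The weight of `A`, signed by the parity of `n - A.dim`. -/
noncomputable def signedWeight (n : ℕ) (A : SqMat) : Polynomial ℤ :=
  (-1) ^ (n - A.dim) * X ^ A.rsum 0

theorem LastSplits.signedWeight_eq_neg {n : ℕ} {A B : SqMat} (hB : MemM n B) (h : LastSplits A B) :
    signedWeight n A = -signedWeight n B := by
  obtain ⟨j, m, hs, -⟩ := h
  have hd : B.dim = A.dim + 1 := hs.dim_eq
  have hle := hB.dim_le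
  rw [signedWeight, signedWeight, hs.rsum_zero, show n - A.dim = n - B.dim + 1 by omega]
  ring

open Classical in
theorem sum_signedWeight_not_proper (n : ℕ) :
    ∑ A ∈ (finite_setOf_memM n).toFinset with ¬ A.Proper, signedWeight n A = 0 := by
  rw [← Finset.sum_filter_add_sum_filter_not _ Splittable, ← eq_neg_iff_add_eq_zero,
    ← Finset.sum_neg_distrib]
  have hex : ∀ A : SqMat, MemM n A ∧ A.Splittable → ∃ B, MemM n B ∧ LastSplits A B :=
    fun A h => h.1.exists_lastSplits_right h.2
  choose f hf hfs using hex
  have key : ∀ A ∈ {A ∈ {A ∈ (finite_setOf_memM n).toFinset | ¬ A.Proper} | A.Splittable},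
      MemM n A ∧ A.Splittable := fun A hA => by
    simp only [Finset.mem_filter, Set.Finite.mem_toFinset, Set.mem_ofPred_eq] at hA
    exact ⟨hA.1.1, hA.2⟩
  refine Finset.sum_bij (fun A hA => f A (key A hA)) (fun A hA => ?_) (fun A hA A' hA' h => ?_)
    (fun B hB => ?_) fun A hA => ?_
  · simp only [Finset.mem_filter, Set.Finite.mem_toFinset, Set.mem_ofPred_eq]
    exact ⟨⟨hf _ _, (hfs _ _).not_proper_right⟩, (hfs _ _).not_splittable_right⟩
  · exact (hfs A (key A hA)).left_unique (h ▸ hfs A' (key A' hA'))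
  · simp only [Finset.mem_filter, Set.Finite.mem_toFinset, Set.mem_ofPred_eq] at hB
    obtain ⟨A, hA, hAB⟩ := hB.1.1.exists_lastSplits_left hB.1.2 hB.2
    obtain ⟨j, hj, h2⟩ := hAB.splittable_left
    refine ⟨A, ?_, (hfs _ _).right_unique hAB⟩
    simp only [Finset.mem_filter, Set.Finite.mem_toFinset, Set.mem_ofPred_eq]
    exact ⟨⟨hA, hj.not_proper⟩, hAB.splittable_left⟩
  · exact (hfs _ _).signedWeight_eq_neg (hf _ _)

end SqMat

/-- For every positive integer `n`, the weight of the even-parity matrices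
of `M_n` minus the weight of the odd-parity ones equals the weight of `PM_n`, where the
weight of `A` is `z ^ rsum_1 A` (here the polynomial variable `X` plays the role of `z`,
and row `0` is the first row). -/
theorem weight_even_sub_weight_odd_eq_weight_proper (n : ℕ) (hn : 0 < n) :
    (∑ᶠ A ∈ {A : SqMat | SqMat.MemM n A ∧ Even (n - A.dim)},
        (X : Polynomial ℤ) ^ A.rsum 0)
      - (∑ᶠ A ∈ {A : SqMat | SqMat.MemM n A ∧ Odd (n - A.dim)},
        (X : Polynomial ℤ) ^ A.rsum 0)
    = ∑ᶠ A ∈ {A : SqMat | SqMat.MemPM n A}, (X : Polynomial ℤ) ^ A.rsum 0 := by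
  classical
  have hfin := SqMat.finite_setOf_memM n
  have hset : ∀ p : SqMat → Prop,
      {A : SqMat | SqMat.MemM n A ∧ p A} = ↑(hfin.toFinset.filter p) := fun p => by
    ext A; simp
  have hpm : {A : SqMat | SqMat.MemPM n A} = ↑(hfin.toFinset.filter SqMat.Proper) := hset _
  rw [hset, hset, hpm, finsum_mem_coe_finset, finsum_mem_coe_finset, finsum_mem_coe_finset]
  calc _ = ∑ A ∈ hfin.toFinset, SqMat.signedWeight n A := by
        rw [← Finset.sum_filter_add_sum_filter_not hfin.toFinset
          (fun A : SqMat => Even (n - A.dim)), sub_eq_add_neg, ← Finset.sum_neg_distrib]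
        congr 1
        · refine Finset.sum_congr (by ext; simp) fun A hA => ?_
          rw [SqMat.signedWeight, (Finset.mem_filter.1 hA).2.neg_one_pow, one_mul]
        · refine Finset.sum_congr (by ext; simp) fun A hA => ?_
          rw [SqMat.signedWeight,
            (Nat.not_even_iff_odd.1 (Finset.mem_filter.1 hA).2).neg_one_pow, neg_one_mul]
    _ = ∑ A ∈ hfin.toFinset with A.Proper, SqMat.signedWeight n A := by
        rw [← Finset.sum_filter_add_sum_filter_not hfin.toFinset SqMat.Proper,
          SqMat.sum_signedWeight_not_proper, add_zero]
    _ = _ := Finset.sum_congr rfl fun A hA => by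
        obtain ⟨hM, hP⟩ := Finset.mem_filter.1 hA
        rw [SqMat.signedWeight, SqMat.MemPM.dim_eq ⟨hfin.mem_toFinset.1 hM, hP⟩,
          Nat.sub_self, pow_zero, one_mul]
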